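/- Assume the standard setup with r ≥ 2, and let 2 ≤ i ≤ r. Assume e + s·nᵢ ≥ c_r if i < r and e + s·nᵢ ≥ c_{r−1} if i = r, where s ≥ 1 if nᵢ = 1 and s ≥ 2 is even if nᵢ ≥ 2. If c₁ = e < c₂ and b = 1, then χ_la(G(Vᵢ,s)) = s·nᵢ + t − r + 2. -/

import Mathlib

open Finset
open scoped Classical

namespace LocalAntimagic

variable {V : Type*}

/-- The induced vertex label: sum of the labels of edges incident to `v`. -/
noncomputable def vertexSum [Fintype V] (G : SimpleGraph V) (f : Sym2 V → ℕ) (v : V) : ℕ :=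
  ∑ e ∈ G.incidenceFinset v, f e

/-- `f` is a local antimagic labeling of `G`: a bijection from the edge set onto
`{1, …, |E|}` whose induced vertex labels distinguish adjacent vertices. -/
def IsLocalAntimagic [Fintype V] (G : SimpleGraph V) (f : Sym2 V → ℕ) : Prop :=
  Set.BijOn f G.edgeSet (Set.Icc 1 G.edgeFinset.card) ∧
  ∀ ⦃u v : V⦄, G.Adj u v → vertexSum G f u ≠ vertexSum G f v

/-- The color number `c(f)`: the number of distinct induced vertex labels. -/
noncomputable def colorCount [Fintype V] (G : SimpleGraph V) (f : Sym2 V → ℕ) : ℕ :=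
  (Finset.univ.image (vertexSum G f)).card

/-- The local antimagic chromatic number. -/
noncomputable def chiLA [Fintype V] (G : SimpleGraph V) : ℕ :=
  sInf {n | ∃ f, IsLocalAntimagic G f ∧ colorCount G f = n}

/-- A pendant vertex is a vertex of degree 1. -/
def IsPendant [Fintype V] (G : SimpleGraph V) (v : V) : Prop :=
  G.degree v = 1

/-- The number of pendant vertices of `G`. -/
noncomputable def pendantCount [Fintype V] (G : SimpleGraph V) : ℕ :=
  (Finset.univ.filter (fun v => IsPendant G v)).card

/-- `G(S, s)`: the graph obtained from `G` by attaching `s` new pendant edges to every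
vertex of `S`.  The new pendant vertex attached to `w ∈ S` via the `j`-th new edge is
`Sum.inr (w, j)`; the original graph lives on the `Sum.inl` vertices. -/
def attachPendants (G : SimpleGraph V) (S : Finset V) (s : ℕ) :
    SimpleGraph (V ⊕ (S × Fin s)) :=
  SimpleGraph.fromRel (fun a b =>
    (∃ u v : V, a = Sum.inl u ∧ b = Sum.inl v ∧ G.Adj u v) ∨
    (∃ (w : S) (j : Fin s), a = Sum.inl (w : V) ∧ b = Sum.inr (w, j)))

/-- The standard setup: `G` is a connected graph with at least `2` edges and
`χ_la(G) = t ≥ 2`; `f` is a local antimagic labeling of `G` with `c(f) = t` whose color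
classes are `Vset 1, …, Vset t` (each nonempty, with `f⁺ ≡ c i` on `Vset i`, and the
colors `c 1, …, c t` pairwise distinct); every non-pendant vertex lies in
`Vset 1 ∪ ⋯ ∪ Vset r` where `1 ≤ r ≤ t`; each `Vset i` with `r + 1 ≤ i ≤ t` is a
singleton consisting of a pendant vertex; `c 1 < c 2 < ⋯ < c r` and
`c (r+1) < c (r+2) < ⋯ < c t`. -/
structure StandardSetup [Fintype V] (G : SimpleGraph V) (f : Sym2 V → ℕ)
    (t r : ℕ) (Vset : ℕ → Finset V) (c : ℕ → ℕ) : Prop where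
  connected : G.Connected
  two_le_card_edges : 2 ≤ G.edgeFinset.card
  chiLA_eq : chiLA G = t
  two_le_t : 2 ≤ t
  antimagic : IsLocalAntimagic G f
  colorCount_eq : colorCount G f = t
  color_on_class : ∀ i ∈ Finset.Icc 1 t, ∀ v ∈ Vset i, vertexSum G f v = c i
  class_cover : ∀ v : V, ∃ i ∈ Finset.Icc 1 t, v ∈ Vset i
  class_nonempty : ∀ i ∈ Finset.Icc 1 t, (Vset i).Nonempty
  color_injective : ∀ i ∈ Finset.Icc 1 t, ∀ j ∈ Finset.Icc 1 t, i ≠ j → c i ≠ c j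
  one_le_r : 1 ≤ r
  r_le_t : r ≤ t
  nonpendant_mem : ∀ v : V, ¬ IsPendant G v → ∃ i ∈ Finset.Icc 1 r, v ∈ Vset i
  pendant_singleton : ∀ i ∈ Finset.Icc (r + 1) t, ∃ v : V, IsPendant G v ∧ Vset i = {v}
  c_strictMono_low : ∀ i j : ℕ, 1 ≤ i → i < j → j ≤ r → c i < c j
  c_strictMono_high : ∀ i j : ℕ, r + 1 ≤ i → i < j → j ≤ t → c i < c j

/-- `b`: the number of pendant vertices of `G` lying in `Vset 1 ∪ ⋯ ∪ Vset r`. -/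
noncomputable def pendantsInLow [Fintype V] (G : SimpleGraph V)
    (Vset : ℕ → Finset V) (r : ℕ) : ℕ :=
  (((Finset.Icc 1 r).biUnion Vset).filter (fun v => IsPendant G v)).card

lemma vertexSum_eq_sum_adj [Fintype V] (G : SimpleGraph V) (f : Sym2 V → ℕ) (v : V) :
    vertexSum G f v = ∑ u, if G.Adj v u then f s(v, u) else 0 := by
  rw [← Finset.sum_filter, vertexSum]
  symm
  refine Finset.sum_bij (fun u _ => s(v, u)) ?_ ?_ ?_ (fun _ _ => rfl)
  · intro u hu
    simpa [SimpleGraph.mem_incidenceFinset, SimpleGraph.mk'_mem_incidenceSet_iff] using hu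
  · intro a _ b _ h
    exact Sym2.congr_right.1 h
  · intro e he
    rw [SimpleGraph.mem_incidenceFinset] at he
    obtain ⟨u, rfl⟩ := Sym2.mem_iff_exists.1 he.2
    exact ⟨u, by simpa using he.1, rfl⟩

lemma IsPendant.exists_adj [Fintype V] {G : SimpleGraph V} {v : V} (h : IsPendant G v) :
    ∃ u, G.Adj v u ∧ (∀ w, G.Adj v w → w = u) ∧
      ∀ f : Sym2 V → ℕ, vertexSum G f v = f s(v, u) := by
  obtain ⟨u, hu, huniq⟩ := SimpleGraph.degree_eq_one_iff_existsUnique_adj.1 h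
  refine ⟨u, hu, huniq, fun f => ?_⟩
  rw [vertexSum_eq_sum_adj, Finset.sum_eq_single u]
  · simp [hu]
  · intro w _ hw
    rw [if_neg fun h => hw (huniq w h)]
  · simp

lemma IsPendant.vertexSum_le [Fintype V] {G : SimpleGraph V} {f : Sym2 V → ℕ}
    (hf : IsLocalAntimagic G f) {v : V} (h : IsPendant G v) :
    vertexSum G f v ≤ G.edgeFinset.card := by
  obtain ⟨u, hu, -, hsum⟩ := h.exists_adj
  rw [hsum]
  exact (hf.1.mapsTo (G.mem_edgeSet.2 hu)).2

/-- The end of the edge with the largest label that is not pendant has an induced label larger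
than every edge label, while pendant vertices carry pairwise distinct edge labels. -/
lemma pendantCount_lt_colorCount [Fintype V] {G : SimpleGraph V} {f : Sym2 V → ℕ}
    (hf : IsLocalAntimagic G f) (hpos : 0 < G.edgeFinset.card) :
    pendantCount G < colorCount G f := by
  set P := Finset.univ.filter fun v => IsPendant G v with hP
  have hinj : Set.InjOn (vertexSum G f) P := by
    intro v hv w hw h
    obtain ⟨v', hv', -, hvs⟩ := (show IsPendant G v by simpa [hP] using hv).exists_adj
    obtain ⟨w', hw', -, hws⟩ := (show IsPendant G w by simpa [hP] using hw).exists_adj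
    have h' := h
    rw [hvs, hws] at h
    have := hf.1.injOn (G.mem_edgeSet.2 hv') (G.mem_edgeSet.2 hw') h
    rcases Sym2.eq_iff.1 this with ⟨h1, -⟩ | ⟨h1, h2⟩
    · exact h1
    · subst h1 h2
      exact absurd h' (hf.2 hv')
  obtain ⟨a, ha⟩ : ∃ a, G.edgeFinset.card < vertexSum G f a := by
    obtain ⟨m, hm, hmf⟩ := hf.1.surjOn (show G.edgeFinset.card ∈ Set.Icc 1 _ from ⟨hpos, le_rfl⟩)
    induction m using Sym2.ind with | _ x y => ?_
    have hxy : G.Adj x y := hm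
    have key : ∀ x y : V, G.Adj x y → f s(x, y) = G.edgeFinset.card → ¬ IsPendant G x →
        G.edgeFinset.card < vertexSum G f x := by
      intro x y hxy hmf hx
      obtain ⟨z, hz, hzy⟩ : ∃ z, G.Adj x z ∧ z ≠ y := by
        by_contra! hcon
        exact hx (SimpleGraph.degree_eq_one_iff_existsUnique_adj.2 ⟨y, hxy, hcon⟩)
      have hz1 := (hf.1.mapsTo (G.mem_edgeSet.2 hz)).1
      have : ∑ u ∈ ({y, z} : Finset V), (if G.Adj x u then f s(x, u) else 0) ≤
          vertexSum G f x := by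
        rw [vertexSum_eq_sum_adj]
        exact Finset.sum_le_sum_of_subset (Finset.subset_univ _)
      rw [Finset.sum_pair hzy.symm, if_pos hxy, if_pos hz] at this
      omega
    by_cases hx : IsPendant G x
    · by_cases hy : IsPendant G y
      · obtain ⟨x', hx', hxu, hxs⟩ := hx.exists_adj
        obtain ⟨y', hy', hyu, hys⟩ := hy.exists_adj
        refine absurd ?_ (hf.2 hxy)
        rw [hxs, hys, ← hxu y hxy, ← hyu x hxy.symm, Sym2.eq_swap]
      · exact ⟨y, key y x hxy.symm (by rw [Sym2.eq_swap]; exact hmf) hy⟩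
    · exact ⟨x, key x y hxy hmf hx⟩
  have hlt : P.image (vertexSum G f) ⊂ Finset.univ.image (vertexSum G f) := by
    refine (Finset.ssubset_iff_of_subset (Finset.image_subset_image (Finset.subset_univ _))).2
      ⟨vertexSum G f a, Finset.mem_image_of_mem _ (Finset.mem_univ _), ?_⟩
    intro h
    obtain ⟨v, hv, hva⟩ := Finset.mem_image.1 h
    have := IsPendant.vertexSum_le hf (show IsPendant G v by simpa [hP] using hv)
    omega
  have := Finset.card_lt_card hlt
  rwa [Finset.card_image_of_injOn hinj] at this

section AttachPendants

variable {G : SimpleGraph V} {S : Finset V} {s : ℕ}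

@[simp] lemma attachPendants_adj_inl_inl {u v : V} :
    (attachPendants G S s).Adj (Sum.inl u) (Sum.inl v) ↔ G.Adj u v := by
  simp only [attachPendants, SimpleGraph.fromRel_adj]
  constructor
  · simp [G.adj_comm]
  · intro h
    exact ⟨by simpa using h.ne, Or.inl (Or.inl ⟨u, v, rfl, rfl, h⟩)⟩

@[simp] lemma attachPendants_adj_inl_inr {v : V} {p : S × Fin s} :
    (attachPendants G S s).Adj (Sum.inl v) (Sum.inr p) ↔ (p.1 : V) = v := by
  simp only [attachPendants, SimpleGraph.fromRel_adj]
  constructor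
  · rintro ⟨-, (⟨_, _, -, h, -⟩ | ⟨w, j, h1, h2⟩) | (⟨_, _, h, -⟩ | ⟨w, j, h, -⟩)⟩
    · cases h
    · cases h1; cases h2; rfl
    · cases h
    · cases h
  · rintro rfl
    exact ⟨by simp, Or.inl (Or.inr ⟨p.1, p.2, rfl, rfl⟩)⟩

@[simp] lemma attachPendants_adj_inr_inl {v : V} {p : S × Fin s} :
    (attachPendants G S s).Adj (Sum.inr p) (Sum.inl v) ↔ (p.1 : V) = v := by
  rw [SimpleGraph.adj_comm, attachPendants_adj_inl_inr]

@[simp] lemma not_attachPendants_adj_inr_inr {p q : S × Fin s} :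
    ¬ (attachPendants G S s).Adj (Sum.inr p) (Sum.inr q) := by
  simp [attachPendants, SimpleGraph.fromRel_adj]

/-- The labeling of `attachPendants G S s` that extends `f` by `L` on the new edges. -/
def extendLabeling (f : Sym2 V → ℕ) (L : S × Fin s → ℕ) : Sym2 (V ⊕ (S × Fin s)) → ℕ :=
  Sym2.lift ⟨fun a b => match a, b with
    | Sum.inl u, Sum.inl v => f s(u, v)
    | Sum.inl _, Sum.inr p => L p
    | Sum.inr p, Sum.inl _ => L p
    | Sum.inr _, Sum.inr _ => 0, by
      rintro (a | a) (b | b) <;> simp [Sym2.eq_swap]⟩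

variable {f : Sym2 V → ℕ} {L : S × Fin s → ℕ}

lemma bijOn_extendLabeling {q n : ℕ} (hf : Set.BijOn f G.edgeSet (Set.Icc 1 q))
    (hL : Set.BijOn L Set.univ (Set.Icc (q + 1) (q + n))) :
    Set.BijOn (extendLabeling f L) (attachPendants G S s).edgeSet (Set.Icc 1 (q + n)) := by
  have hmaps : ∀ p, q + 1 ≤ L p ∧ L p ≤ q + n := fun p => hL.mapsTo (Set.mem_univ p)
  have hfm : ∀ {u v}, G.Adj u v → 1 ≤ f s(u, v) ∧ f s(u, v) ≤ q :=
    fun h => hf.mapsTo (G.mem_edgeSet.2 h)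
  have cases : ∀ m ∈ (attachPendants G S s).edgeSet,
      (∃ u v, G.Adj u v ∧ m = s(Sum.inl u, Sum.inl v)) ∨
      ∃ p : S × Fin s, m = s(Sum.inl (p.1 : V), Sum.inr p) := by
    intro m hm
    induction m using Sym2.ind with | _ x y => ?_
    rw [SimpleGraph.mem_edgeSet] at hm
    rcases x with u | p <;> rcases y with v | p'
    · exact Or.inl ⟨u, v, by simpa using hm, rfl⟩
    · exact Or.inr ⟨p', by rw [attachPendants_adj_inl_inr.1 hm]⟩
    · exact Or.inr ⟨p, by rw [attachPendants_adj_inr_inl.1 hm, Sym2.eq_swap]⟩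
    · exact absurd hm not_attachPendants_adj_inr_inr
  have hold : ∀ u v, extendLabeling f L s(Sum.inl u, Sum.inl v) = f s(u, v) := fun _ _ => rfl
  have hnew : ∀ p : S × Fin s, extendLabeling f L s(Sum.inl (p.1 : V), Sum.inr p) = L p :=
    fun _ => rfl
  refine ⟨?_, ?_, ?_⟩
  · intro m hm
    rcases cases m hm with ⟨u, v, h, rfl⟩ | ⟨p, rfl⟩
    · rw [hold]
      exact ⟨(hfm h).1, (hfm h).2.trans (Nat.le_add_right _ _)⟩
    · rw [hnew]
      exact ⟨le_trans (Nat.le_add_left _ _) (hmaps p).1, (hmaps p).2⟩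
  · intro m hm m' hm' heq
    rcases cases m hm with ⟨u, v, h, rfl⟩ | ⟨p, rfl⟩ <;>
      rcases cases m' hm' with ⟨u', v', h', rfl⟩ | ⟨p', rfl⟩ <;>
      simp only [hold, hnew] at heq
    · have := hf.injOn (G.mem_edgeSet.2 h) (G.mem_edgeSet.2 h') heq
      simpa using congrArg (Sym2.map (Sum.inl (β := S × Fin s))) this
    · have := hfm h
      have := hmaps p'
      omega
    · have := hfm h'
      have := hmaps p
      omega
    · rw [hL.injOn (Set.mem_univ p) (Set.mem_univ p') heq]
  · intro k hk
    by_cases hkq : k ≤ q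
    · obtain ⟨m, hm, hmk⟩ := hf.surjOn (show k ∈ Set.Icc 1 q from ⟨hk.1, hkq⟩)
      induction m using Sym2.ind with | _ u v => ?_
      exact ⟨s(Sum.inl u, Sum.inl v), by simpa using hm, hmk⟩
    · obtain ⟨p, -, hp⟩ := hL.surjOn (show k ∈ Set.Icc (q + 1) (q + n) from ⟨by omega, hk.2⟩)
      exact ⟨s(Sum.inl (p.1 : V), Sum.inr p), by simp, hp⟩

variable [Fintype V]

lemma isPendant_attachPendants_inr (p : S × Fin s) :
    IsPendant (attachPendants G S s) (Sum.inr p) := by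
  refine SimpleGraph.degree_eq_one_iff_existsUnique_adj.2 ⟨Sum.inl p.1, by simp, ?_⟩
  rintro (v | q) h
  · rw [attachPendants_adj_inr_inl.1 h]
  · exact absurd h not_attachPendants_adj_inr_inr

lemma IsPendant.attachPendants_inl {v : V} (h : IsPendant G v) (hv : v ∉ S) :
    IsPendant (attachPendants G S s) (Sum.inl v) := by
  obtain ⟨u, hu, huniq, -⟩ := h.exists_adj
  refine SimpleGraph.degree_eq_one_iff_existsUnique_adj.2 ⟨Sum.inl u, by simpa using hu, ?_⟩
  rintro (w | p) hw
  · rw [huniq w (attachPendants_adj_inl_inl.1 hw)]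
  · exact absurd (attachPendants_adj_inl_inr.1 hw ▸ p.1.2) hv

lemma le_pendantCount_attachPendants (hS : ∀ v ∈ S, ¬ IsPendant G v) :
    s * S.card + pendantCount G ≤ pendantCount (attachPendants G S s) := by
  have hsub : (Finset.univ.filter fun v => IsPendant G v).disjSum
      (Finset.univ : Finset (S × Fin s)) ⊆
      Finset.univ.filter fun v => IsPendant (attachPendants G S s) v := by
    rintro (v | p) h
    · have hv : IsPendant G v := by simpa using h
      simpa using hv.attachPendants_inl fun h => hS v h hv
    · simpa using isPendant_attachPendants_inr p
  have := Finset.card_le_card hsub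
  rw [Finset.card_disjSum] at this
  simp only [Finset.card_univ, Fintype.card_prod, Fintype.card_coe, Fintype.card_fin] at this
  unfold pendantCount
  rw [mul_comm s, add_comm]
  exact this

lemma vertexSum_extendLabeling_inl (v : V) :
    vertexSum (attachPendants G S s) (extendLabeling f L) (Sum.inl v) =
      vertexSum G f v + ∑ p, if (p.1 : V) = v then L p else 0 := by
  simp [vertexSum_eq_sum_adj, Fintype.sum_sum_type, extendLabeling]

lemma vertexSum_extendLabeling_inl_of_notMem {v : V} (hv : v ∉ S) :
    vertexSum (attachPendants G S s) (extendLabeling f L) (Sum.inl v) = vertexSum G f v := by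
  rw [vertexSum_extendLabeling_inl, Finset.sum_eq_zero, add_zero]
  intro p _
  have hp : (p.1 : V) ≠ v := by
    rintro rfl
    exact hv p.1.2
  exact if_neg hp

lemma vertexSum_extendLabeling_inl_of_mem (w : S) :
    vertexSum (attachPendants G S s) (extendLabeling f L) (Sum.inl w) =
      vertexSum G f w + ∑ j, L (w, j) := by
  rw [vertexSum_extendLabeling_inl, Fintype.sum_prod_type, Finset.sum_eq_single w]
  · simp
  · intro x _ hx
    exact Finset.sum_eq_zero fun j _ => if_neg fun h => hx (Subtype.ext h)
  · simp

lemma vertexSum_extendLabeling_inr (p : S × Fin s) :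
    vertexSum (attachPendants G S s) (extendLabeling f L) (Sum.inr p) = L p := by
  simp [vertexSum_eq_sum_adj, Fintype.sum_sum_type, extendLabeling]

end AttachPendants

/-- A bijective labeling of an `n × s` array by consecutive integers with constant row sums
exists when there is a single row or `s` is even. -/
lemma exists_labeling_const_rowSum (S : Finset V) (s q : ℕ) (h : S.card ≤ 1 ∨ Even s) :
    ∃ (L : S × Fin s → ℕ) (M : ℕ),
      Set.BijOn L Set.univ (Set.Icc (q + 1) (q + s * S.card)) ∧ ∀ w, ∑ j, L (w, j) = M := by
  set n := S.card with hn
  let φ : S ≃ Fin n := S.equivFin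
  let r : ℕ → ℕ → ℕ := fun a j => q + (j * n + if Even j then a + 1 else n - a)
  let L : S × Fin s → ℕ := fun p => r (φ p.1) p.2
  have hr : ∀ a j, a < n → ∃ d, d < n ∧ r a j = q + (j * n + d + 1) ∧
      d = if Even j then a else n - 1 - a := by
    intro a j ha
    by_cases hj : Even j
    · exact ⟨a, ha, by simp only [r, if_pos hj]; omega, by simp [hj]⟩
    · exact ⟨n - 1 - a, by omega, by simp only [r, if_neg hj]; omega, by simp [hj]⟩
  have hmaps : Set.MapsTo L Set.univ (Set.Icc (q + 1) (q + s * n)) := by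
    intro p _
    obtain ⟨d, hd, hrd, -⟩ := hr (φ p.1) p.2 (φ p.1).2
    have h1 : ((p.2 : ℕ) + 1) * n ≤ s * n := Nat.mul_le_mul_right n p.2.2
    rw [add_mul, one_mul] at h1
    simp only [L, hrd, Set.mem_Icc]
    omega
  have hinj : Function.Injective L := by
    rintro ⟨w, j⟩ ⟨w', j'⟩ heq
    obtain ⟨d, hd, hrd, hdd⟩ := hr (φ w) j (φ w).2
    obtain ⟨d', hd', hrd', hdd'⟩ := hr (φ w') j' (φ w').2
    simp only [L, hrd, hrd'] at heq
    have heq' : (j : ℕ) * n + d = j' * n + d' := by omega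
    have hn0 : 0 < n := by omega
    have hj : (j : ℕ) = j' := by
      have h1 : ((j : ℕ) * n + d) / n = j := by
        rw [mul_comm, Nat.mul_add_div hn0, Nat.div_eq_of_lt hd, add_zero]
      have h2 : ((j' : ℕ) * n + d') / n = j' := by
        rw [mul_comm, Nat.mul_add_div hn0, Nat.div_eq_of_lt hd', add_zero]
      rw [← h1, heq', h2]
    rw [hj] at heq' hdd
    have h3 : d = d' := by omega
    have hw : (φ w : ℕ) = φ w' := by
      have := (φ w).2
      have := (φ w').2
      split_ifs at hdd hdd' <;> omega
    rw [Fin.ext hj, φ.injective (Fin.ext hw)]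
  have hbij : Set.BijOn L Set.univ (Set.Icc (q + 1) (q + s * n)) := by
    refine ⟨hmaps, hinj.injOn, ?_⟩
    have hsub : Finset.univ.image L ⊆ Finset.Icc (q + 1) (q + s * n) := by
      intro k hk
      obtain ⟨p, -, rfl⟩ := Finset.mem_image.1 hk
      exact Finset.mem_Icc.2 (hmaps (Set.mem_univ p))
    have himg := Finset.eq_of_subset_of_card_le hsub (by
      rw [Finset.card_image_of_injective _ hinj, Nat.card_Icc, Finset.card_univ,
        Fintype.card_prod, Fintype.card_coe, Fintype.card_fin, ← hn, mul_comm n]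
      omega)
    intro k hk
    have : k ∈ Finset.univ.image L := by rw [himg]; exact Finset.mem_Icc.2 hk
    obtain ⟨p, -, hp⟩ := Finset.mem_image.1 this
    exact ⟨p, Set.mem_univ p, hp⟩
  have hconst : ∀ a b, a < n → b < n →
      ∑ j ∈ Finset.range s, r a j = ∑ j ∈ Finset.range s, r b j := by
    intro a b ha hb
    rcases h with h | ⟨m, rfl⟩
    · rw [show a = b by omega]
    · clear hmaps hinj hbij L
      induction m with
      | zero => simp
      | succ m ih =>
        have he : Even (m + m) := ⟨m, rfl⟩
        have ho : ¬ Even (m + m + 1) := by simp [Nat.even_add_one]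
        rw [show m + 1 + (m + 1) = m + m + 1 + 1 by ring]
        simp only [Finset.sum_range_succ _ (m + m + 1), Finset.sum_range_succ _ (m + m), ih]
        simp only [r, if_pos he, if_neg ho]
        omega
  have hrow : ∀ w, ∑ j, L (w, j) = ∑ j ∈ Finset.range s, r (φ w) j := fun w =>
    Fin.sum_univ_eq_sum_range (fun j => r (φ w) j) s
  refine ⟨L, ∑ j ∈ Finset.range s, r 0 j, hbij, fun w => ?_⟩
  rw [hrow]
  exact hconst _ _ (φ w).2 (lt_of_le_of_lt (Nat.zero_le _) (φ w).2)

lemma StandardSetup.le_pendantCount [Fintype V] {G : SimpleGraph V} {f : Sym2 V → ℕ}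
    {t r : ℕ} {Vset : ℕ → Finset V} {c : ℕ → ℕ} (setup : StandardSetup G f t r Vset c) :
    pendantsInLow G Vset r + (t - r) ≤ pendantCount G := by
  have hex : ∀ k, ∃ v, k ∈ Finset.Icc (r + 1) t → IsPendant G v ∧ Vset k = {v} := by
    intro k
    by_cases hk : k ∈ Finset.Icc (r + 1) t
    · obtain ⟨v, hv⟩ := setup.pendant_singleton k hk
      exact ⟨v, fun _ => hv⟩
    · exact ⟨(setup.class_nonempty 1 (by have := setup.two_le_t; simp; omega)).choose,
        fun h => absurd h hk⟩
  choose x hx using hex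
  have hcol : ∀ k ∈ Finset.Icc (r + 1) t, vertexSum G f (x k) = c k := by
    intro k hk
    refine setup.color_on_class k ?_ _ (by rw [(hx k hk).2]; simp)
    simp only [Finset.mem_Icc] at hk ⊢
    omega
  have hinj : Set.InjOn x (Finset.Icc (r + 1) t) := by
    intro k hk l hl hkl
    by_contra hne
    have hk' := hk
    have hl' := hl
    simp only [Finset.coe_Icc, Set.mem_Icc] at hk' hl'
    refine setup.color_injective k (by simp; omega) l (by simp; omega) hne ?_
    rw [← hcol k (by simpa using hk), ← hcol l (by simpa using hl), hkl]
  have hdisj : Disjoint (((Finset.Icc 1 r).biUnion Vset).filter fun v => IsPendant G v)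
      ((Finset.Icc (r + 1) t).image x) := by
    rw [Finset.disjoint_right]
    intro v hv hv'
    obtain ⟨k, hk, rfl⟩ := Finset.mem_image.1 hv
    obtain ⟨l, hl, hxl⟩ := Finset.mem_biUnion.1 (Finset.mem_filter.1 hv').1
    have hrt := setup.r_le_t
    have h1 := hcol k hk
    simp only [Finset.mem_Icc] at hk hl
    have h2 := setup.color_on_class l (by simp; omega) _ hxl
    exact setup.color_injective k (by simp; omega) l (by simp; omega) (by omega) (h1 ▸ h2)
  have hsub : (((Finset.Icc 1 r).biUnion Vset).filter fun v => IsPendant G v) ∪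
      ((Finset.Icc (r + 1) t).image x) ⊆ Finset.univ.filter fun v => IsPendant G v := by
    intro v hv
    rcases Finset.mem_union.1 hv with h | h
    · simpa using (Finset.mem_filter.1 h).2
    · obtain ⟨k, hk, rfl⟩ := Finset.mem_image.1 h
      simpa using (hx k hk).1
  have := Finset.card_le_card hsub
  rw [Finset.card_union_of_disjoint hdisj, Finset.card_image_of_injOn hinj, Nat.card_Icc] at this
  unfold pendantsInLow pendantCount
  omega

/-- Theorem 2.1(2), "moreover" part: in the standard setup with
`r ≥ 2`, for `2 ≤ i ≤ r`, if `e + s·nᵢ ≥ c_r` when `i < r` and `e + s·nᵢ ≥ c_{r-1}`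
when `i = r`, where `s ≥ 1` if `nᵢ = 1` and `s ≥ 2` is even if `nᵢ ≥ 2`, and
`c₁ = e < c₂` with `b = 1`, then `χ_la(G(Vᵢ, s)) = s·nᵢ + t - r + 2`. -/
theorem chiLA_attachPendants_eq_c1 [Fintype V] (G : SimpleGraph V)
    (f : Sym2 V → ℕ) (t r : ℕ) (Vset : ℕ → Finset V) (c : ℕ → ℕ)
    (setup : StandardSetup G f t r Vset c) (hr : 2 ≤ r)
    (e s i : ℕ) (he : G.edgeFinset.card = e)
    (hb : pendantsInLow G Vset r = 1)
    (hi₁ : 2 ≤ i) (hi₂ : i ≤ r)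
    (hbig₁ : i < r → c r ≤ e + s * (Vset i).card)
    (hbig₂ : i = r → c (r - 1) ≤ e + s * (Vset i).card)
    (hs₁ : (Vset i).card = 1 → 1 ≤ s)
    (hs₂ : 2 ≤ (Vset i).card → 2 ≤ s ∧ Even s)
    (hce₁ : c 1 = e) (hce₂ : e < c 2) :
    chiLA (attachPendants G (Vset i) s) = s * (Vset i).card + (t - r) + 2 := by
  set S := Vset i with hS
  have hrt := setup.r_le_t
  have hef : Set.BijOn f G.edgeSet (Set.Icc 1 e) := he ▸ setup.antimagic.1
  have he2 : 2 ≤ e := he ▸ setup.two_le_card_edges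
  have hmemi : i ∈ Finset.Icc 1 t := Finset.mem_Icc.2 (by omega)
  have hSpos : 0 < S.card := Finset.card_pos.2 (setup.class_nonempty i hmemi)
  have hspos : 1 ≤ s := by
    by_cases h1 : S.card = 1
    · exact hs₁ h1
    · have := (hs₂ (by omega)).1
      omega
  have hci : e < c i := by
    rcases hi₁.eq_or_lt with rfl | h
    · exact hce₂
    · exact hce₂.trans (setup.c_strictMono_low 2 i (by omega) h hi₂)
  have hSsum : ∀ v ∈ S, vertexSum G f v = c i := setup.color_on_class i hmemi
  have hpend : ∀ v, IsPendant G v → vertexSum G f v ≤ e := fun v hv =>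
    he ▸ hv.vertexSum_le setup.antimagic
  have hSnp : ∀ v ∈ S, ¬ IsPendant G v := by
    intro v hv hp
    have := hpend v hp
    have := hSsum v hv
    omega
  obtain ⟨L, M, hL, hLM⟩ := exists_labeling_const_rowSum S s e (by
    by_cases h1 : S.card ≤ 1
    · exact Or.inl h1
    · exact Or.inr (hs₂ (by omega)).2)
  set N := s * S.card with hN
  have hNpos : 0 < N := Nat.mul_pos hspos hSpos
  have hMge : e + N ≤ M := by
    obtain ⟨p, -, hp⟩ := hL.surjOn (show e + N ∈ Set.Icc (e + 1) (e + N) from ⟨by omega, le_rfl⟩)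
    rw [← hLM p.1, ← hp]
    exact Finset.single_le_sum (f := fun j => L (p.1, j)) (fun _ _ => Nat.zero_le _)
      (Finset.mem_univ p.2)
  have hlow : ∀ k, 1 ≤ k → k ≤ r → k ≠ i → e ≤ c k ∧ c k ≤ e + N := by
    intro k hk1 hkr hki
    have hmono : ∀ a b, 1 ≤ a → a ≤ b → b ≤ r → c a ≤ c b := by
      intro a b ha hab hb
      rcases hab.eq_or_lt with rfl | h
      · exact le_rfl
      · exact (setup.c_strictMono_low a b ha h hb).le
    refine ⟨hce₁ ▸ hmono 1 k le_rfl hk1 hkr, ?_⟩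
    rcases hi₂.eq_or_lt with h | h
    · exact (hmono k (r - 1) hk1 (by omega) (by omega)).trans (hbig₂ h)
    · exact (hmono k r hk1 hkr le_rfl).trans (hbig₁ h)
  have hother : ∀ v ∉ S, (e ≤ vertexSum G f v ∧ vertexSum G f v ≤ e + N) ∨
      (vertexSum G f v ≤ e ∧ vertexSum G f v ∈ (Finset.Icc (r + 1) t).image c) := by
    intro v hv
    obtain ⟨k, hk, hvk⟩ := setup.class_cover v
    have hck := setup.color_on_class k hk v hvk
    have hki : k ≠ i := by
      rintro rfl
      exact hv hvk
    rw [Finset.mem_Icc] at hk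
    rw [hck]
    by_cases hkr : k ≤ r
    · exact Or.inl (hlow k hk.1 hkr hki)
    · have hk' : k ∈ Finset.Icc (r + 1) t := Finset.mem_Icc.2 (by omega)
      obtain ⟨w, hw, hVk⟩ := setup.pendant_singleton k hk'
      rw [hVk, Finset.mem_singleton] at hvk
      subst hvk
      exact Or.inr ⟨hck ▸ hpend v hw, Finset.mem_image_of_mem c hk'⟩
  have hotherle : ∀ v ∉ S, vertexSum G f v ≤ e + N := by
    intro v hv
    rcases hother v hv with h | h <;> omega
  have hLle : ∀ p, e + 1 ≤ L p ∧ L p ≤ e + N := fun p => hL.mapsTo (Set.mem_univ p)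
  let g := extendLabeling f L
  have hin : ∀ v ∈ S, vertexSum (attachPendants G S s) g (Sum.inl v) = c i + M := by
    intro v hv
    rw [vertexSum_extendLabeling_inl_of_mem ⟨v, hv⟩, hLM, hSsum v hv]
  have hout : ∀ v ∉ S, vertexSum (attachPendants G S s) g (Sum.inl v) = vertexSum G f v :=
    fun v hv => vertexSum_extendLabeling_inl_of_notMem hv
  have hnew : ∀ p, vertexSum (attachPendants G S s) g (Sum.inr p) = L p :=
    vertexSum_extendLabeling_inr
  have hbij := bijOn_extendLabeling hef hL
  have hcard : (attachPendants G S s).edgeFinset.card = e + N := by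
    rw [Set.BijOn.finsetCard_eq (t := Finset.Icc 1 (e + N)) g (by simpa using hbij), Nat.card_Icc]
    omega
  have hg : IsLocalAntimagic (attachPendants G S s) g := by
    refine ⟨hcard ▸ hbij, ?_⟩
    rintro (u | p) (v | p') huv
    · have huv' := setup.antimagic.2 (attachPendants_adj_inl_inl.1 huv)
      by_cases hu : u ∈ S <;> by_cases hv : v ∈ S
      · exact absurd ((hSsum u hu).trans (hSsum v hv).symm) huv'
      · have := hotherle v hv
        rw [hin u hu, hout v hv]
        omega
      · have := hotherle u hu
        rw [hout u hu, hin v hv]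
        omega
      · rwa [hout u hu, hout v hv]
    · have := hLle p'
      rw [hin u (attachPendants_adj_inl_inr.1 huv ▸ p'.1.2), hnew]
      omega
    · have := hLle p
      rw [hin v (attachPendants_adj_inr_inl.1 huv ▸ p.1.2), hnew]
      omega
    · exact absurd huv not_attachPendants_adj_inr_inr
  have hupper : colorCount (attachPendants G S s) g ≤ N + (t - r) + 2 := by
    have hsub : Finset.univ.image (vertexSum (attachPendants G S s) g) ⊆
        insert (c i + M) (Finset.Icc e (e + N) ∪ (Finset.Icc (r + 1) t).image c) := by
      intro k hk
      obtain ⟨a, -, rfl⟩ := Finset.mem_image.1 hk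
      rw [Finset.mem_insert, Finset.mem_union, Finset.mem_Icc]
      rcases a with v | p
      · by_cases hv : v ∈ S
        · exact Or.inl (hin v hv)
        · rw [hout v hv]
          exact Or.inr ((hother v hv).imp id And.right)
      · have := hLle p
        rw [hnew]
        exact Or.inr (Or.inl (by omega))
    have h1 := Finset.card_le_card hsub
    have h2 := Finset.card_insert_le (c i + M)
      (Finset.Icc e (e + N) ∪ (Finset.Icc (r + 1) t).image c)
    have h3 := Finset.card_union_le (Finset.Icc e (e + N)) ((Finset.Icc (r + 1) t).image c)
    have h4 : ((Finset.Icc (r + 1) t).image c).card ≤ _ := Finset.card_image_le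
    rw [Nat.card_Icc] at h3 h4
    unfold colorCount
    omega
  have hlower : ∀ g', IsLocalAntimagic (attachPendants G S s) g' →
      N + (t - r) + 2 ≤ colorCount (attachPendants G S s) g' := by
    intro g' hg'
    have h1 := pendantCount_lt_colorCount hg' (by omega)
    have h2 := le_pendantCount_attachPendants (s := s) hSnp
    have h3 := setup.le_pendantCount
    omega
  have hle : chiLA (attachPendants G S s) ≤ colorCount (attachPendants G S s) g :=
    Nat.sInf_le ⟨g, hg, rfl⟩
  refine le_antisymm (hle.trans hupper) ?_
  refine le_csInf ⟨_, g, hg, rfl⟩ ?_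
  rintro _ ⟨g', hg', rfl⟩
  exact hlower g' hg'

end LocalAntimagic
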